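/- arXiv:2402.10473 — 2 statements merged into one kernel-verified Lean document; each statement's English description precedes it below -/
import Mathlib

section
/- An ε-LDP mechanism leaks at most ε nats of information: let X and Z be random variables taking values in finite sets 𝒳 and 𝒵, with joint distribution given by a prior p_X on 𝒳 and a Markov kernel K from 𝒳 to 𝒵 satisfying ε-LDP (so p_{XZ}(x,z) = p_X(x) K(z|x)). Then the mutual information satisfies I(X; Z) ≤ ε. -/
open Finset

/-- A Markov kernel between finite types: each row is a probability mass function. -/
def IsMarkovKernel' {A B : Type*} [Fintype B] (K : A → B → ℝ) : Prop :=
  (∀ a b, 0 ≤ K a b) ∧ ∀ a, ∑ b, K a b = 1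

/-- ε-local differential privacy for a kernel. -/
def IsLDP {A B : Type*} (ε : ℝ) (K : A → B → ℝ) : Prop :=
  ∀ a a' b, K a b ≤ Real.exp ε * K a' b

/-- Mutual information (in nats) of the joint distribution `p(x,z) = pX x * K x z`,
with the convention that terms with zero joint probability vanish. -/
noncomputable def miPriorKernel {X Z : Type*} [Fintype X] [Fintype Z]
    (pX : X → ℝ) (K : X → Z → ℝ) : ℝ :=
  ∑ x, ∑ z, (pX x * K x z) *
    Real.log ((pX x * K x z) / (pX x * ∑ x', pX x' * K x' z))

/-- Each row of an `ε`-LDP kernel is at most `exp ε` times any mixture of the rows. -/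
lemma IsLDP.le_exp_mul_sum {A B : Type*} [Fintype A] {ε : ℝ} {K : A → B → ℝ} (hK : IsLDP ε K)
    {p : A → ℝ} (hp0 : ∀ a, 0 ≤ p a) (hp1 : ∑ a, p a = 1) (a : A) (b : B) :
    K a b ≤ Real.exp ε * ∑ a', p a' * K a' b :=
  calc K a b = ∑ a', p a' * K a b := by rw [← Finset.sum_mul, hp1, one_mul]
    _ ≤ ∑ a', p a' * (Real.exp ε * K a' b) :=
        Finset.sum_le_sum fun a' _ => mul_le_mul_of_nonneg_left (hK a a' b) (hp0 a')
    _ = Real.exp ε * ∑ a', p a' * K a' b := by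
        rw [Finset.mul_sum]
        exact Finset.sum_congr rfl fun _ _ => mul_left_comm _ _ _

/-- An ε-LDP mechanism leaks at most ε nats of information: `I(X;Z) ≤ ε`. -/
theorem ldp_mutual_information_bound
    {X Z : Type*} [Fintype X] [Fintype Z] [Nonempty X] [Nonempty Z]
    (ε : ℝ) (hε : 0 ≤ ε) (K : X → Z → ℝ)
    (hK : IsMarkovKernel' K) (hLDP : IsLDP ε K)
    (pX : X → ℝ) (hp0 : ∀ x, 0 ≤ pX x) (hp1 : ∑ x, pX x = 1) :
    miPriorKernel pX K ≤ ε := by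
  have hterm (x : X) (z : Z) : (pX x * K x z) *
      Real.log ((pX x * K x z) / (pX x * ∑ x', pX x' * K x' z)) ≤ (pX x * K x z) * ε := by
    rcases (hp0 x).eq_or_lt with hp | hp
    · simp [← hp]
    rcases (hK.1 x z).eq_or_lt with hk | hk
    · simp [← hk]
    have hle := hLDP.le_exp_mul_sum hp0 hp1 x z
    have hq : 0 < ∑ x', pX x' * K x' z :=
      pos_of_mul_pos_right (hk.trans_le hle) (Real.exp_pos ε).le
    rw [mul_div_mul_left _ _ hp.ne']
    refine mul_le_mul_of_nonneg_left ?_ (mul_pos hp hk).le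
    rwa [Real.log_le_iff_le_exp (div_pos hk hq), div_le_iff₀ hq]
  calc miPriorKernel pX K ≤ ∑ x, ∑ z, (pX x * K x z) * ε :=
        Finset.sum_le_sum fun x _ => Finset.sum_le_sum fun z _ => hterm x z
    _ = ε := by simp only [← Finset.sum_mul, ← Finset.mul_sum, hK.2, mul_one, hp1, one_mul]
end

section
/- Bound on sensitive information leakage: let S, X, Z be random variables on finite sets such that S and Z are conditionally independent given X (the Markov chain S → X → Z), and suppose the conditional distribution of Z given X is realized by a Markov kernel K from 𝒳 to 𝒵 satisfying ε-LDP. If I(X; Z | S) ≥ ν, then the sensitive information leakage satisfies I(S; Z) ≤ ε − ν. -/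
open Finset

noncomputable section

variable {S X Z : Type*} [Fintype S] [Fintype X] [Fintype Z]

/-- Marginal of the sensitive variable. -/
def margS (p : S → X → Z → ℝ) (s : S) : ℝ := ∑ x, ∑ z, p s x z

/-- Marginal of the data variable. -/
def margX (p : S → X → Z → ℝ) (x : X) : ℝ := ∑ s, ∑ z, p s x z

/-- Marginal of the representation variable. -/
def margZ (p : S → X → Z → ℝ) (z : Z) : ℝ := ∑ s, ∑ x, p s x z

/-- Marginal of the pair `(S, X)`. -/
def margSX (p : S → X → Z → ℝ) (s : S) (x : X) : ℝ := ∑ z, p s x z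

/-- Marginal of the pair `(S, Z)`. -/
def margSZ (p : S → X → Z → ℝ) (s : S) (z : Z) : ℝ := ∑ x, p s x z

/-- Marginal of the pair `(X, Z)`. -/
def margXZ (p : S → X → Z → ℝ) (x : X) (z : Z) : ℝ := ∑ s, p s x z

/-- Mutual information `I(S;Z)` in nats (zero-probability terms vanish). -/
def miSZ (p : S → X → Z → ℝ) : ℝ :=
  ∑ s, ∑ z, margSZ p s z * Real.log (margSZ p s z / (margS p s * margZ p z))

/-- Conditional mutual information `I(X;Z∣S)` in nats (zero-probability terms vanish,
and division by zero is zero by convention). -/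
def cmiXZgivenS (p : S → X → Z → ℝ) : ℝ :=
  ∑ s, margS p s * ∑ x, ∑ z,
    (p s x z / margS p s) *
      Real.log ((p s x z / margS p s) /
        ((margSX p s x / margS p s) * (margSZ p s z / margS p s)))

/-- The Markov chain `S → X → Z`: `p(s, z | x) = p(s|x) p(z|x)` whenever `p(x) > 0`. -/
def MarkovSXZ (p : S → X → Z → ℝ) : Prop :=
  ∀ x, 0 < margX p x → ∀ s z,
    p s x z / margX p x = (margSX p s x / margX p x) * (margXZ p x z / margX p x)

/-- Under the Markov chain, the joint law factors through the kernel. -/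
theorem joint_eq_margSX_mul_kernel {p : S → X → Z → ℝ} (hMarkov : MarkovSXZ p)
    {K : X → Z → ℝ} (hreal : ∀ x z, margXZ p x z = margX p x * K x z)
    {x : X} (hx : 0 < margX p x) (s : S) (z : Z) :
    p s x z = margSX p s x * K x z := by
  have h := hMarkov x hx s z
  rw [hreal] at h
  field_simp at h
  exact h

theorem sum_margX (p : S → X → Z → ℝ) : ∑ x, margX p x = ∑ s, ∑ x, ∑ z, p s x z :=
  Finset.sum_comm

theorem margZ_eq_sum_margXZ (p : S → X → Z → ℝ) (z : Z) : margZ p z = ∑ x, margXZ p x z :=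
  Finset.sum_comm

/-- An ε-LDP kernel is bounded by `exp ε` times the output marginal. -/
theorem kernel_le_exp_mul_margZ {ε : ℝ} {p : S → X → Z → ℝ}
    (hp0 : ∀ s x z, 0 ≤ p s x z) (hp1 : ∑ s, ∑ x, ∑ z, p s x z = 1)
    {K : X → Z → ℝ} (hLDP : IsLDP ε K)
    (hreal : ∀ x z, margXZ p x z = margX p x * K x z) (x : X) (z : Z) :
    K x z ≤ Real.exp ε * margZ p z := by
  have hX (x' : X) : 0 ≤ margX p x' :=
    Finset.sum_nonneg fun s _ => Finset.sum_nonneg fun z _ => hp0 s x' z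
  calc K x z = ∑ x', margX p x' * K x z := by
        rw [← Finset.sum_mul, sum_margX, hp1, one_mul]
    _ ≤ ∑ x', margX p x' * (Real.exp ε * K x' z) :=
        Finset.sum_le_sum fun x' _ => mul_le_mul_of_nonneg_left (hLDP x x' z) (hX x')
    _ = Real.exp ε * margZ p z := by
        rw [margZ_eq_sum_margXZ, Finset.mul_sum]
        refine Finset.sum_congr rfl fun x' _ => ?_
        rw [hreal]
        ring

/-- The chain-rule summand of `I(S;Z) + I(X;Z∣S)` is at most `ε` times the joint mass. -/
theorem chain_summand_le {ε : ℝ} {p : S → X → Z → ℝ}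
    (hp0 : ∀ s x z, 0 ≤ p s x z) (hp1 : ∑ s, ∑ x, ∑ z, p s x z = 1)
    (hMarkov : MarkovSXZ p) {K : X → Z → ℝ} (hLDP : IsLDP ε K)
    (hreal : ∀ x z, margXZ p x z = margX p x * K x z) (s : S) (x : X) (z : Z) :
    p s x z * Real.log (margSZ p s z / (margS p s * margZ p z)) +
      margS p s * ((p s x z / margS p s) * Real.log ((p s x z / margS p s) /
        ((margSX p s x / margS p s) * (margSZ p s z / margS p s)))) ≤ p s x z * ε := by
  rcases (hp0 s x z).eq_or_lt with h0 | hpos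
  · simp [← h0]
  have hSX : 0 < margSX p s x := hpos.trans_le <|
    Finset.single_le_sum (f := fun z => p s x z) (fun z _ => hp0 s x z) (Finset.mem_univ z)
  have hSZ : 0 < margSZ p s z := hpos.trans_le <|
    Finset.single_le_sum (f := fun x => p s x z) (fun x _ => hp0 s x z) (Finset.mem_univ x)
  have hS : 0 < margS p s := hSX.trans_le <|
    Finset.single_le_sum (f := fun x => margSX p s x)
      (fun x _ => Finset.sum_nonneg fun z _ => hp0 s x z) (Finset.mem_univ x)
  have hX : 0 < margX p x := hSX.trans_le <|
    Finset.single_le_sum (f := fun s => margSX p s x)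
      (fun s _ => Finset.sum_nonneg fun z _ => hp0 s x z) (Finset.mem_univ s)
  have hZ : 0 < margZ p z := hSZ.trans_le <|
    Finset.single_le_sum (f := fun s => margSZ p s z)
      (fun s _ => Finset.sum_nonneg fun x _ => hp0 s x z) (Finset.mem_univ s)
  have hfac := joint_eq_margSX_mul_kernel hMarkov hreal hX s z
  have hK : 0 < K x z := pos_of_mul_pos_right (hfac ▸ hpos) hSX.le
  have hratio : margSZ p s z / (margS p s * margZ p z) * ((p s x z / margS p s) /
      ((margSX p s x / margS p s) * (margSZ p s z / margS p s))) = K x z / margZ p z := by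
    rw [hfac]
    field_simp
  rw [← mul_assoc, mul_div_cancel₀ _ hS.ne', ← mul_add,
    ← Real.log_mul (by positivity) (by positivity), hratio]
  refine mul_le_mul_of_nonneg_left ?_ hpos.le
  rw [Real.log_le_iff_le_exp (by positivity), div_le_iff₀ hZ]
  exact kernel_le_exp_mul_margZ hp0 hp1 hLDP hreal x z

/-- Bound on sensitive information leakage: under the Markov chain `S → X → Z` with an
ε-LDP kernel realizing the conditional of `Z` given `X`, if `I(X;Z∣S) ≥ ν` then
`I(S;Z) ≤ ε − ν`. -/
theorem sensitive_leakage_bound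
    [Nonempty S] [Nonempty X] [Nonempty Z]
    (ε ν : ℝ) (hε : 0 ≤ ε)
    (p : S → X → Z → ℝ)
    (hp0 : ∀ s x z, 0 ≤ p s x z) (hp1 : ∑ s, ∑ x, ∑ z, p s x z = 1)
    (hMarkov : MarkovSXZ p)
    (K : X → Z → ℝ) (hK : IsMarkovKernel' K) (hLDP : IsLDP ε K)
    (hreal : ∀ x z, margXZ p x z = margX p x * K x z)
    (hν : ν ≤ cmiXZgivenS p) :
    miSZ p ≤ ε - ν := by
  have hmi : miSZ p = ∑ s, ∑ x, ∑ z,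
      p s x z * Real.log (margSZ p s z / (margS p s * margZ p z)) := by
    refine Finset.sum_congr rfl fun s _ => ?_
    rw [Finset.sum_comm]
    refine Finset.sum_congr rfl fun z _ => ?_
    rw [← Finset.sum_mul]
    rfl
  have hsum : miSZ p + cmiXZgivenS p ≤ ε := by
    calc miSZ p + cmiXZgivenS p ≤ ∑ s, ∑ x, ∑ z, p s x z * ε := by
          rw [hmi, cmiXZgivenS]
          simp only [Finset.mul_sum, ← Finset.sum_add_distrib]
          gcongr with s _ x _ z _
          exact chain_summand_le hp0 hp1 hMarkov hLDP hreal s x z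
      _ = ε := by simp only [← Finset.sum_mul, hp1, one_mul]
  linarith

end
end
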